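/- arXiv:math/0608593 — 3 statements merged into one kernel-verified Lean document; each statement's English description precedes it below -/
import Mathlib

section
/- If (S, H) is admissible with d(S) = 12 and h_m(S,H) = 0 for every m with 1 ≤ m ≤ 6, then H = 1/30 and S is the multiset {1/5, 1/3, 1/2, 0, 0}. -/
/-- The periodized second Bernoulli polynomial `B(x) = {x}² − {x} + 1/6`. -/
def bernB (x : ℚ) : ℚ := Int.fract x ^ 2 - Int.fract x + 1 / 6

/-- `d(S) = Σ_{z ∈ S} den(z)`: the sum of the denominators (in lowest terms)
of the elements of the multiset `S`. -/
def dS (S : Multiset ℚ) : ℕ := (S.map fun z => z.den).sum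

/-- `λ_m(S) = Σ_{z ∈ S} den(z)·B(m·z)`. -/
def lamS (m : ℕ) (S : Multiset ℚ) : ℚ :=
  (S.map fun z => (z.den : ℚ) * bernB (m * z)).sum

/-- `h_m(S,H) = m²·H − λ_m(S)`. -/
def hS (m : ℕ) (S : Multiset ℚ) (H : ℚ) : ℚ := (m : ℚ) ^ 2 * H - lamS m S

/-- `(S, H)` is admissible: `S` is a multiset of rationals in `[0, 1/2]`, `H > 0`,
each `h_m(S,H)` is a nonnegative even integer, and `h_{m′}(S,H) ≤ h_m(S,H)`
whenever `m′ ∣ m`. -/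
def Admissible (S : Multiset ℚ) (H : ℚ) : Prop :=
  (∀ z ∈ S, 0 ≤ z ∧ z ≤ 1 / 2) ∧ 0 < H ∧
  (∀ m : ℕ, 0 < m → ∃ k : ℕ, hS m S H = 2 * k) ∧
  (∀ m m' : ℕ, 0 < m' → 0 < m → m' ∣ m → hS m' S H ≤ hS m S H)

/-- The Möbius condition: `Σ_{m′ ∣ m} μ(m/m′)·h_{m′}(S,H) ≥ 0` for all `m ≥ 1`. -/
def MoebiusCond (S : Multiset ℚ) (H : ℚ) : Prop :=
  ∀ m : ℕ, 0 < m →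
    0 ≤ ∑ m' ∈ m.divisors, (ArithmeticFunction.moebius (m / m') : ℚ) * hS m' S H

/-- The rationals in `[0, 1/2]` with denominator at most `12`. -/
def smallRats : List ℚ :=
  [0, 1 / 2, 1 / 3, 1 / 4, 1 / 5, 2 / 5, 1 / 6, 1 / 7, 2 / 7, 3 / 7, 1 / 8, 3 / 8,
    1 / 9, 2 / 9, 4 / 9, 1 / 10, 3 / 10, 1 / 11, 2 / 11, 3 / 11, 4 / 11, 5 / 11, 1 / 12, 5 / 12]

/-- The multisets of elements of a list of rationals whose denominators sum to `n`. -/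
def multisetsWithDenSum : List ℚ → ℕ → List (Multiset ℚ)
  | [], n => if n = 0 then [0] else []
  | z :: C, n => (List.range (n + 1)).flatMap fun k =>
      if k * z.den ≤ n then
        (multisetsWithDenSum C (n - k * z.den)).map (Multiset.replicate k z + ·)
      else []

theorem dS_add (S T : Multiset ℚ) : dS (S + T) = dS S + dS T := by
  simp [dS]

theorem dS_replicate (k : ℕ) (z : ℚ) : dS (Multiset.replicate k z) = k * z.den := by
  simp [dS]

theorem den_le_dS {S : Multiset ℚ} {z : ℚ} (hz : z ∈ S) : z.den ≤ dS S :=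
  Multiset.single_le_sum (fun _ _ => Nat.zero_le _) _ (Multiset.mem_map_of_mem _ hz)

theorem mem_multisetsWithDenSum (C : List ℚ) (S : Multiset ℚ) (hSC : ∀ z ∈ S, z ∈ C) :
    S ∈ multisetsWithDenSum C (dS S) := by
  induction C generalizing S with
  | nil =>
    have : S = 0 := Multiset.eq_zero_of_forall_notMem fun z hz => by simpa using hSC z hz
    subst this
    simp [multisetsWithDenSum, dS]
  | cons z C ih =>
    set T := S.filter (fun x => ¬ x = z)
    have hsplit : Multiset.replicate (S.count z) z + T = S := by
      rw [← Multiset.filter_eq' S z]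
      exact Multiset.filter_add_not _ S
    have hsum : dS S = S.count z * z.den + dS T := by
      rw [← dS_replicate, ← dS_add, hsplit]
    have hT : T ∈ multisetsWithDenSum C (dS T) := by
      refine ih T fun x hx => ?_
      obtain ⟨hxS, hxz⟩ := Multiset.mem_filter.1 hx
      exact (List.mem_cons.1 (hSC x hxS)).resolve_left hxz
    have hcount : S.count z ≤ S.count z * z.den := Nat.le_mul_of_pos_right _ z.den_pos
    rw [multisetsWithDenSum, List.mem_flatMap]
    refine ⟨S.count z, List.mem_range.2 (by omega), ?_⟩
    rw [if_pos (by omega), List.mem_map]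
    exact ⟨T, by rwa [hsum, Nat.add_sub_cancel_left], hsplit⟩

theorem natCast_div_mem_smallRats :
    ∀ d ∈ List.range 13, ∀ a ∈ List.range 7, 0 < d → 2 * a ≤ d →
      ((a : ℚ) / (d : ℚ)) ∈ smallRats := by
  decide +kernel

theorem mem_smallRats {z : ℚ} (h0 : 0 ≤ z) (h1 : z ≤ 1 / 2) (hden : z.den ≤ 12) :
    z ∈ smallRats := by
  obtain ⟨a, ha⟩ := Int.eq_ofNat_of_zero_le (Rat.num_nonneg.2 h0)
  have hz : z = (a : ℚ) / (z.den : ℚ) := by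
    conv_lhs => rw [← Rat.num_div_den z, ha]
    simp
  have hpos : (0 : ℚ) < z.den := by exact_mod_cast z.den_pos
  have hle : 2 * a ≤ z.den := by
    rw [hz, div_le_iff₀ hpos] at h1
    have : (2 * a : ℚ) ≤ z.den := by linarith
    exact_mod_cast this
  rw [hz]
  exact natCast_div_mem_smallRats z.den (List.mem_range.2 (by omega)) a
    (List.mem_range.2 (by omega)) z.den_pos hle

theorem eq_of_lamS_quadratic :
    ∀ S ∈ multisetsWithDenSum smallRats 12,
      (∀ m ∈ [2, 3, 4, 5, 6], lamS m S = (m : ℚ) ^ 2 * lamS 1 S) →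
        S = {1 / 5, 1 / 3, 1 / 2, 0, 0} := by
  decide +kernel

theorem lamS_one_eq : lamS 1 {1 / 5, 1 / 3, 1 / 2, 0, 0} = 1 / 30 := by
  decide +kernel

theorem stmt_14 (S : Multiset ℚ) (H : ℚ) (hadm : Admissible S H)
    (hd : dS S = 12) (hzero : ∀ m : ℕ, 1 ≤ m → m ≤ 6 → hS m S H = 0) :
    H = 1 / 30 ∧ S = ({1 / 5, 1 / 3, 1 / 2, 0, 0} : Multiset ℚ) := by
  have hlam : ∀ m : ℕ, 1 ≤ m → m ≤ 6 → lamS m S = (m : ℚ) ^ 2 * H := fun m h1 h6 =>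
    (sub_eq_zero.1 (hzero m h1 h6)).symm
  have hH : lamS 1 S = H := by simpa using hlam 1 le_rfl (by norm_num)
  have hmem : S ∈ multisetsWithDenSum smallRats 12 := by
    rw [← hd]
    exact mem_multisetsWithDenSum _ S fun z hz =>
      mem_smallRats (hadm.1 z hz).1 (hadm.1 z hz).2 (hd ▸ den_le_dS hz)
  have hSeq : S = {1 / 5, 1 / 3, 1 / 2, 0, 0} := by
    refine eq_of_lamS_quadratic S hmem fun m hm => ?_
    have hm' : 1 ≤ m ∧ m ≤ 6 := by
      simp only [List.mem_cons, List.not_mem_nil, or_false] at hm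
      omega
    rw [hH, hlam m hm'.1 hm'.2]
  exact ⟨by rw [← hH, hSeq, lamS_one_eq], hSeq⟩
end

section
/- If (S, H) is admissible, satisfies the Möbius condition, and d(S) = 24, then H ≥ 11/420; moreover H = 11/420 holds if and only if h_m(S,H) = 0 for every m with 1 ≤ m ≤ 8. -/
/-- The least common multiple of `1, …, 24`. -/
def commonDen : ℕ := 5354228880

/-- For `p = (a, N)`, the integer `commonDen · r (N - r) / N` with `r = m a mod N`; this is
`commonDen · (N / 6 - N · B(m a / N))`. -/
def defect (m : ℕ) (p : ℕ × ℕ) : ℕ :=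
  (m * p.1 % p.2) * (p.2 - m * p.1 % p.2) * (commonDen / p.2)

/-- The sum of the defects of a list of pairs `(a, N)`. -/
def totalDefect (m : ℕ) : List (ℕ × ℕ) → ℕ
  | [] => 0
  | p :: l => defect m p + totalDefect m l

/-- The pairs `(a, N)` in lowest terms with `N ≤ 24` and `a / N ∈ [0, 1/2]`, sorted by `N`. -/
def fracPairs : List (ℕ × ℕ) :=
  (List.range 25).flatMap fun N =>
    ((List.range (N / 2 + 1)).filter fun a => Nat.gcd a N == 1 && Nat.blt 0 N).map fun a => (a, N)

/-- If `x = L · H` and `V m = L · (4 - λ_m)`, this is `L · (h_m + 4)`. -/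
def shiftedHeight (V : ℕ → ℕ) (x m : ℕ) : ℕ := m ^ 2 * x + V m

/-- The residue of `L · H` modulo `2 · L`, in `(0, 2 · L]`. -/
def heightResidue (L : ℕ) (V : ℕ → ℕ) : ℕ := 2 * L - V 1 % (2 * L)

/-- `h_1 = ⋯ = h_8 = 0`, in terms of the values `g m = L · (h_m + 4)`. -/
def allZero (L : ℕ) (g : ℕ → ℕ) : Bool :=
  [1, 2, 3, 4, 5, 6, 7, 8].all fun m => Nat.beq (g m) (4 * L)

/-- The instances of nonnegativity, monotonicity and the Möbius condition that are needed. -/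
def fewConditions (L : ℕ) (g : ℕ → ℕ) : Bool :=
  ([1, 2, 3, 4, 5, 6, 7, 8, 9, 10].all fun m => Nat.ble (4 * L) (g m)) &&
    Nat.ble (g 4) (g 8) && Nat.ble (g 5) (g 10) && Nat.ble (g 3) (g 6) &&
    Nat.ble (g 6 + g 4) (g 12 + g 2)

/-- The claim for a configuration with `V m = L · (4 - λ_m)`. -/
def configOk (L : ℕ) (V : ℕ → ℕ) : Bool :=
  (Nat.ble (11 * L) (420 * heightResidue L V) &&
    (Nat.beq (420 * heightResidue L V) (11 * L) ==
      allZero L (shiftedHeight V (heightResidue L V)))) ||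
  !(fewConditions L (shiftedHeight V (heightResidue L V)))

/-- Checks `configOk` for all extensions of `ch` by pairs from `zs` with denominator sum `rem`. -/
def searchOk : ℕ → List (ℕ × ℕ) → ℕ → List (ℕ × ℕ) → Bool
  | 0, _, _, _ => false
  | _ + 1, _, 0, ch => configOk commonDen fun m => totalDefect m ch
  | _ + 1, [], _ + 1, _ => true
  | f + 1, z :: zs, rem + 1, ch =>
    bif Nat.ble z.2 (rem + 1) then
      searchOk f (z :: zs) (rem + 1 - z.2) (z :: ch) && searchOk f zs (rem + 1) ch
    else true

theorem searchOk_fracPairs : searchOk 130 fracPairs 24 [] = true := by decide +kernel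

theorem fracPairs_sorted : fracPairs.Pairwise fun p q => p.2 ≤ q.2 := by decide +kernel

theorem mem_fracPairs {a N : ℕ} (hN : 0 < N) (hN' : N ≤ 24) (ha : 2 * a ≤ N)
    (hc : Nat.Coprime a N) : (a, N) ∈ fracPairs := by
  simp only [fracPairs, List.mem_flatMap, List.mem_range, List.mem_map, List.mem_filter,
    Prod.mk.injEq, Bool.and_eq_true, beq_iff_eq, Nat.blt_eq]
  exact ⟨N, by omega, a, ⟨by omega, hc, hN⟩, rfl, rfl⟩

/-- Soundness of the search: every extension is equivalent to one that was checked. -/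
theorem exists_configOk_of_searchOk (f : ℕ) : ∀ (zs : List (ℕ × ℕ)) (rem : ℕ)
    (ch : List (ℕ × ℕ)), zs.Pairwise (fun p q => p.2 ≤ q.2) → searchOk f zs rem ch = true →
    ∀ T : Multiset (ℕ × ℕ), (∀ t ∈ T, t ∈ zs ∧ 0 < t.2) → (T.map Prod.snd).sum = rem →
      ∃ l : List (ℕ × ℕ), (l : Multiset (ℕ × ℕ)) = T + (ch : Multiset (ℕ × ℕ)) ∧
        configOk commonDen (fun m => totalDefect m l) = true := by
  induction f with
  | zero => intro zs rem ch _ h; simp [searchOk] at h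
  | succ f ih =>
    intro zs rem ch hs h T hT hsum
    have hle : ∀ t ∈ T, t.2 ≤ rem := fun t ht => hsum ▸
      Multiset.single_le_sum (fun _ _ => Nat.zero_le _) _ (Multiset.mem_map_of_mem _ ht)
    rcases rem with _ | rem
    · have : T = 0 := Multiset.eq_zero_of_forall_notMem fun t ht => by
        have := hle t ht
        have := (hT t ht).2
        omega
      subst this
      exact ⟨ch, by simp, by simpa [searchOk] using h⟩
    · rcases zs with _ | ⟨z, zs⟩
      · have : T = 0 := Multiset.eq_zero_of_forall_notMem fun t ht => by
          simpa using (hT t ht).1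
        subst this
        simp at hsum
      · have hne : T ≠ 0 := by rintro rfl; simp at hsum
        obtain ⟨t, ht⟩ := Multiset.exists_mem_of_ne_zero hne
        have hz : z.2 ≤ rem + 1 := by
          refine le_trans ?_ (hle t ht)
          rcases List.mem_cons.1 (hT t ht).1 with rfl | h'
          · exact le_rfl
          · exact (List.pairwise_cons.1 hs).1 t h'
        have hz' : Nat.ble z.2 (rem + 1) = true := Nat.ble_eq ▸ hz
        rw [searchOk, hz', cond_true, Bool.and_eq_true] at h
        by_cases hzT : z ∈ T
        · obtain ⟨T', rfl⟩ := Multiset.exists_cons_of_mem hzT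
          obtain ⟨l, hl, hok⟩ := ih (z :: zs) (rem + 1 - z.2) (z :: ch) hs h.1 T'
            (fun t ht => hT t (Multiset.mem_cons_of_mem ht))
            (by rw [Multiset.map_cons, Multiset.sum_cons] at hsum; omega)
          refine ⟨l, ?_, hok⟩
          rw [hl, ← Multiset.cons_coe, Multiset.add_cons, Multiset.cons_add]
        · refine ih zs (rem + 1) ch (List.pairwise_cons.1 hs).2 h.2 T (fun t ht => ⟨?_, (hT t ht).2⟩)
            hsum
          rcases List.mem_cons.1 (hT t ht).1 with rfl | h'
          · exact absurd ht hzT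
          · exact h'

theorem totalDefect_eq_sum (m : ℕ) (l : List (ℕ × ℕ)) :
    totalDefect m l = ((l : Multiset (ℕ × ℕ)).map (defect m)).sum := by
  induction l with
  | nil => rfl
  | cons p l ih =>
    rw [totalDefect, ih, ← Multiset.cons_coe, Multiset.map_cons, Multiset.sum_cons]

theorem dvd_commonDen {N : ℕ} (hN : 0 < N) (hN' : N ≤ 24) : N ∣ commonDen := by
  unfold commonDen
  interval_cases N <;> norm_num

/-- The pair (numerator, denominator) of a nonnegative rational. -/
def fracPair (z : ℚ) : ℕ × ℕ := (z.num.toNat, z.den)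

theorem den_mul_bernB {z : ℚ} (hz : 0 ≤ z) (hden : z.den ≤ 24) (m : ℕ) :
    commonDen * (z.den * bernB (m * z)) = commonDen * z.den / 6 - defect m (fracPair z) := by
  obtain ⟨a, ha⟩ : ∃ a : ℕ, z.num = a := Int.eq_ofNat_of_zero_le (Rat.num_nonneg.2 hz)
  have hN := z.den_pos
  obtain ⟨k, hk⟩ := dvd_commonDen hN hden
  set N := z.den with hNdef
  have hz' : (m : ℚ) * z = ((m * a : ℕ) : ℚ) / (N : ℚ) := by
    conv_lhs => rw [← Rat.num_div_den z, ha]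
    push_cast
    ring
  have hlt : m * a % N ≤ N := (Nat.mod_lt _ hN).le
  have hdef : defect m (fracPair z) = (m * a % N) * (N - m * a % N) * k := by
    simp [defect, fracPair, ha, ← hNdef, hk, Nat.mul_div_cancel_left k hN]
  have hNq : (N : ℚ) ≠ 0 := by positivity
  rw [hdef, bernB, hz', Int.fract_div_natCast_eq_div_natCast_mod, hk]
  push_cast [hlt]
  field_simp
  ring

theorem commonDen_mul_lamS (m : ℕ) (S : Multiset ℚ) (hS01 : ∀ z ∈ S, 0 ≤ z ∧ z.den ≤ 24) :
    commonDen * lamS m S =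
      commonDen * dS S / 6 - (((S.map fracPair).map (defect m)).sum : ℕ) := by
  induction S using Multiset.induction with
  | empty => simp [lamS, dS]
  | cons z S ih =>
    have h1 := den_mul_bernB (hS01 z (Multiset.mem_cons_self _ _)).1
      (hS01 z (Multiset.mem_cons_self _ _)).2 m
    have h2 := ih fun w hw => hS01 w (Multiset.mem_cons_of_mem hw)
    simp only [lamS, dS, Multiset.map_cons, Multiset.sum_cons, Nat.cast_add] at h1 h2 ⊢
    rw [mul_add, h1, h2]
    ring

theorem allZero_eq_true_iff (L : ℕ) (g : ℕ → ℕ) :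
    allZero L g = true ↔ ∀ m : ℕ, 1 ≤ m → m ≤ 8 → g m = 4 * L := by
  simp only [allZero, List.all_eq_true, Nat.beq_eq]
  refine forall_congr' fun m => ⟨fun h h1 h8 => h ?_, fun h hm => ?_⟩
  · interval_cases m <;> simp
  · simp at hm
    exact h (by omega) (by omega)

/-- For `d(S) = 24` the numbers `h_m` are read off from integers passing the check. -/
theorem exists_configOk (S : Multiset ℚ) (hS01 : ∀ z ∈ S, 0 ≤ z ∧ z ≤ 1 / 2) (hd : dS S = 24) :
    ∃ (L : ℕ) (V : ℕ → ℕ), 0 < L ∧ configOk L V = true ∧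
      ∀ (m : ℕ) (H : ℚ), L * hS m S H = m ^ 2 * (L * H) + V m - 4 * L := by
  have hden : ∀ z ∈ S, z.den ≤ 24 := fun z hz => hd ▸
    Multiset.single_le_sum (fun _ _ => Nat.zero_le _) _
      (Multiset.mem_map_of_mem (fun z : ℚ => z.den) hz)
  obtain ⟨l, hl, hok⟩ := exists_configOk_of_searchOk 130 fracPairs 24 [] fracPairs_sorted
    searchOk_fracPairs (S.map fracPair) (by
      intro t ht
      obtain ⟨z, hz, rfl⟩ := Multiset.mem_map.1 ht
      refine ⟨mem_fracPairs z.den_pos (hden z hz) ?_ ?_, z.den_pos⟩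
      · have h2 := (hS01 z hz).2
        have h0 := Rat.num_nonneg.2 (hS01 z hz).1
        rw [Rat.le_iff] at h2
        norm_num at h2
        omega
      · have := z.reduced
        have h0 := Rat.num_nonneg.2 (hS01 z hz).1
        rwa [show z.num.natAbs = z.num.toNat by omega] at this)
    (by rw [Multiset.map_map]; exact hd)
  refine ⟨commonDen, fun m => totalDefect m l, by norm_num [commonDen], hok, fun m H => ?_⟩
  have := commonDen_mul_lamS m S fun z hz => ⟨(hS01 z hz).1, hden z hz⟩
  rw [hd] at this
  beta_reduce
  rw [totalDefect_eq_sum, hl, Multiset.coe_nil, add_zero, hS, mul_sub, this]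
  push_cast
  ring

theorem sub_mod_eq_of_add_eq {M y V k : ℕ} (hy : 0 < y) (hyM : y ≤ M)
    (h : y + V = M * (k + 1)) : M - V % M = y := by
  have hV : V = (M - y) + M * k := by
    rw [mul_add] at h
    omega
  rw [hV, Nat.add_mul_mod_self_left, Nat.mod_eq_of_lt (by omega)]
  omega

theorem stmt_15 (S : Multiset ℚ) (H : ℚ) (hadm : Admissible S H)
    (hmu : MoebiusCond S H) (hd : dS S = 24) :
    11 / 420 ≤ H ∧ (H = 11 / 420 ↔ ∀ m : ℕ, 1 ≤ m → m ≤ 8 → hS m S H = 0) := by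
  obtain ⟨hS01, hHpos, heven, hmono⟩ := hadm
  obtain ⟨L, V, hLpos', hok, hheight⟩ := exists_configOk S hS01 hd
  have hLpos : (0 : ℚ) < L := by exact_mod_cast hLpos'
  obtain ⟨k, hk⟩ := heven 1 one_pos
  have h1 := hheight 1 H
  rw [hk] at h1
  norm_num at h1
  -- the integer `L * H`
  obtain ⟨y, hy⟩ : ∃ y : ℕ, (L : ℚ) * H = y := by
    have hyz : (L : ℚ) * H
        = ((2 * k * L + 4 * L - V 1 : ℤ) : ℚ) := by
      push_cast
      linarith
    have hnn : (0 : ℤ) ≤ 2 * k * L + 4 * L - V 1 := by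
      have : (0 : ℚ) ≤ (L : ℚ) * H := by positivity
      rw [hyz] at this
      exact_mod_cast this
    obtain ⟨y, hy⟩ := Int.eq_ofNat_of_zero_le hnn
    exact ⟨y, by rw [hyz, hy]; rfl⟩
  have hypos : 0 < y := by
    have : (0 : ℚ) < y := by rw [← hy]; positivity
    exact_mod_cast this
  have hg : ∀ m, (shiftedHeight V y m : ℚ) = L * hS m S H + 4 * L := by
    intro m
    rw [hheight, hy, shiftedHeight]
    push_cast
    ring
  have hle : ∀ {a b : ℕ}, hS a S H ≤ hS b S H → shiftedHeight V y a ≤ shiftedHeight V y b := by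
    intro a b hab
    have : (shiftedHeight V y a : ℚ) ≤ shiftedHeight V y b := by
      rw [hg, hg]
      gcongr
    exact_mod_cast this
  have hnonneg : ∀ m, 0 < m → 4 * L ≤ shiftedHeight V y m := by
    intro m hm
    obtain ⟨k, hk⟩ := heven m hm
    have : ((4 * L : ℕ) : ℚ) ≤ shiftedHeight V y m := by
      rw [hg, hk]
      push_cast
      have : (0 : ℚ) ≤ L * (2 * k) := by positivity
      linarith
    exact_mod_cast this
  have hmoebius : shiftedHeight V y 6 + shiftedHeight V y 4
      ≤ shiftedHeight V y 12 + shiftedHeight V y 2 := by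
    have h12 := hmu 12 (by norm_num)
    have hdiv : (12 : ℕ).divisors = {1, 2, 3, 4, 6, 12} := by decide
    have e1 : ArithmeticFunction.moebius 1 = 1 := by simp
    have e2 : ArithmeticFunction.moebius 2 = -1 :=
      ArithmeticFunction.moebius_apply_prime Nat.prime_two
    have e3 : ArithmeticFunction.moebius 3 = -1 :=
      ArithmeticFunction.moebius_apply_prime Nat.prime_three
    have e4 : ArithmeticFunction.moebius 4 = 0 :=
      ArithmeticFunction.moebius_eq_zero_of_not_squarefree (by decide)
    have e6 : ArithmeticFunction.moebius 6 = 1 := by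
      rw [show 6 = 2 * 3 from rfl,
        ArithmeticFunction.isMultiplicative_moebius.map_mul_of_coprime (by norm_num), e2, e3]
      norm_num
    have e12 : ArithmeticFunction.moebius 12 = 0 :=
      ArithmeticFunction.moebius_eq_zero_of_not_squarefree (by decide)
    rw [hdiv] at h12
    norm_num [e1, e2, e3, e4, e6, e12] at h12
    have : (shiftedHeight V y 6 + shiftedHeight V y 4 : ℚ)
        ≤ shiftedHeight V y 12 + shiftedHeight V y 2 := by
      simp only [hg]
      nlinarith
    exact_mod_cast this
  have hzero : (∀ m : ℕ, 1 ≤ m → m ≤ 8 → hS m S H = 0) ↔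
      allZero L (shiftedHeight V y) = true := by
    rw [allZero_eq_true_iff]
    refine forall_congr' fun m => imp_congr_right fun _ => imp_congr_right fun _ => ?_
    rw [← @Nat.cast_inj ℚ, hg]
    push_cast
    simp [hLpos'.ne']
  have hfew : fewConditions L (shiftedHeight V y) = true := by
    simp only [fewConditions, Bool.and_eq_true, Nat.ble_eq, List.all_eq_true]
    refine ⟨⟨⟨⟨fun m hm => hnonneg m ?_, ?_⟩, ?_⟩, ?_⟩, hmoebius⟩
    · simp at hm
      omega
    · exact hle (hmono 8 4 (by norm_num) (by norm_num) (by norm_num))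
    · exact hle (hmono 10 5 (by norm_num) (by norm_num) (by norm_num))
    · exact hle (hmono 6 3 (by norm_num) (by norm_num) (by norm_num))
  have hHle : 11 / 420 ≤ H ↔ 11 * L ≤ 420 * y := by
    rw [← @Nat.cast_le ℚ]
    push_cast
    rw [← hy]
    constructor <;> intro h <;> nlinarith
  have hHeq : H = 11 / 420 ↔ 420 * y = 11 * L := by
    rw [← @Nat.cast_inj ℚ]
    push_cast
    rw [← hy]
    constructor
    · rintro rfl
      ring
    · intro h
      have : (L : ℚ) * (420 * H) = L * 11 := by linarith
      have := mul_left_cancel₀ hLpos.ne' this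
      linarith
  rw [hzero, hHle, hHeq]
  by_cases hbig : y ≤ 2 * L
  · have hsum : y + V 1 = 2 * L * (k + 1 + 1) := by
      have : (y + V 1 : ℚ) = 2 * L * (k + 1 + 1) := by
        rw [← hy]
        linarith
      exact_mod_cast this
    have hres : heightResidue L V = y := sub_mod_eq_of_add_eq hypos hbig hsum
    rw [configOk, hres, hfew] at hok
    simp only [Bool.not_true, Bool.or_false, Bool.and_eq_true, Nat.ble_eq, beq_iff_eq] at hok
    refine ⟨hok.1, ?_⟩
    rw [← hok.2, Nat.beq_eq]
  · refine ⟨by omega, fun h => by omega, fun h => ?_⟩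
    have h2 := (allZero_eq_true_iff _ _).1 h 2 (by norm_num) (by norm_num)
    rw [shiftedHeight] at h2
    omega
end

section
/- If (S, H) is admissible, satisfies the Möbius condition, has cardinality |S| ≥ 9 (elements counted with multiplicity), and d(S) = 36, then H ≥ 23/840; moreover H = 23/840 holds if and only if h_m(S,H) = 0 for every m with 1 ≤ m ≤ 9. -/
/-- The fractions `a / b` in `[0, 1/2]` in lowest terms with `b ≤ 28`, as pairs `(a, b)` sorted by
value. -/
def halfFarey : List (ℕ × ℕ) :=
  [(0, 1), (1, 28), (1, 27), (1, 26), (1, 25), (1, 24), (1, 23), (1, 22), (1, 21), (1, 20),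
   (1, 19), (1, 18), (1, 17), (1, 16), (1, 15), (1, 14), (2, 27), (1, 13), (2, 25), (1, 12),
   (2, 23), (1, 11), (2, 21), (1, 10), (2, 19), (3, 28), (1, 9), (3, 26), (2, 17), (3, 25),
   (1, 8), (3, 23), (2, 15), (3, 22), (1, 7), (4, 27), (3, 20), (2, 13), (3, 19), (4, 25),
   (1, 6), (4, 23), (3, 17), (5, 28), (2, 11), (5, 27), (3, 16), (4, 21), (5, 26), (1, 5),
   (5, 24), (4, 19), (3, 14), (5, 23), (2, 9), (5, 22), (3, 13), (4, 17), (5, 21), (6, 25),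
   (1, 4), (7, 27), (6, 23), (5, 19), (4, 15), (7, 26), (3, 11), (5, 18), (7, 25), (2, 7),
   (7, 24), (5, 17), (8, 27), (3, 10), (7, 23), (4, 13), (5, 16), (6, 19), (7, 22), (8, 25),
   (9, 28), (1, 3), (9, 26), (8, 23), (7, 20), (6, 17), (5, 14), (9, 25), (4, 11), (7, 19),
   (10, 27), (3, 8), (8, 21), (5, 13), (7, 18), (9, 23), (11, 28), (2, 5), (11, 27), (9, 22),
   (7, 17), (5, 12), (8, 19), (11, 26), (3, 7), (10, 23), (7, 16), (11, 25), (4, 9), (9, 20),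
   (5, 11), (11, 24), (6, 13), (13, 28), (7, 15), (8, 17), (9, 19), (10, 21), (11, 23), (12, 25),
   (13, 27), (1, 2)]

/-- With `T(z) = a (b - a) / b` for `z = a / b`, this is the natural number
`m² T(z) - T({m z})`. -/
def bend (m a b : ℕ) : ℕ :=
  b * (m * a / b) * (m * a / b + 1) + m * m * a - (m * a + 2 * m * a * (m * a / b))

/-- The least common multiple of `1, …, 28`. -/
def lcmDen : ℕ := 80313433200

/-- `lcmDen` times `a (b - a) / b`. -/
def scaledT (a b : ℕ) : ℕ := lcmDen / b * (a * (b - a))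

/-- The total of `bend m` over a list of fractions. -/
def listBend (m : ℕ) : List (ℕ × ℕ) → ℕ
  | [] => 0
  | p :: l => bend m p.1 p.2 + listBend m l

/-- The low-height configuration. -/
def extremal : List (ℕ × ℕ) :=
  [(1, 2), (3, 7), (1, 3), (1, 3), (1, 4), (1, 5), (1, 8), (0, 1), (0, 1), (0, 1), (0, 1)]

/-- Acceptance test for a completed configuration: it is too short, or violates the monotonicity
of `h` for some pair `(m, d)` with `d ∣ m`, or is the extremal one. -/
def leafTest (K : ℕ) (l : List (ℕ × ℕ)) : Bool :=
  Nat.blt l.length 9 ||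
  ([(10, 1), (4, 2), (6, 2), (6, 3), (8, 2), (8, 4), (12, 4), (12, 6)].any fun q =>
    Nat.blt (2 * K * (q.1 * q.1) + listBend q.2 l) (2 * K * (q.2 * q.2) + listBend q.1 l)) ||
  l == extremal

/-- Whether a linear bound shows that no multiset of fractions, all at least `a / b` and at most
`1 / 2`, has numerators summing to `A`, denominators summing to `B`, `scaledT` summing to at least
`t`, and `bend m` summing to at most (exactly, if `eq`) `r` for every `(m, r) ∈ rem`. -/
def prune (eq : Bool) (a b A B t : ℕ) (rem : List (ℕ × ℕ)) : Bool :=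
  Nat.blt (A * b) (a * B) || Nat.blt B (2 * A) || Nat.blt (lcmDen * (A * (B - A))) (t * B) ||
  (rem.any fun q => Nat.blt (q.2 * (b - 2 * a))
    ((B - 2 * A) * bend q.1 a b + (A * b - a * B) * bend q.1 1 2)) ||
  (eq && rem.any fun q => Nat.blt (bend q.1 A B) q.2)

/-- Application of `f` to `n`, arranged so that kernel reduction evaluates `n` first. -/
def force : ℕ → (ℕ → Bool) → Bool
  | 0, f => f 0
  | n + 1, f => f n.succ

/-- Application of `f` to `l`, arranged so that kernel reduction evaluates `l` first. -/
def forceList : List (ℕ × ℕ) → (List (ℕ × ℕ) → Bool) → Bool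
  | [], f => f []
  | p :: l, f => force p.1 fun a => force p.2 fun b => forceList l fun l' => f ((a, b) :: l')

theorem force_eq (n : ℕ) (f : ℕ → Bool) : force n f = f n := by
  cases n <;> rfl

theorem forceList_eq (l : List (ℕ × ℕ)) (f : List (ℕ × ℕ) → Bool) : forceList l f = f l := by
  induction l generalizing f with
  | nil => rfl
  | cons p l ih => rw [forceList, force_eq, force_eq, ih]

/-- Exhaustive search over the multisets of elements of the list `zs`, where `l` lists the fractions
already chosen and `A`, `B`, `t`, `rem` are the remaining requirements as in `prune`. -/
def search (K : ℕ) (eq : Bool) :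
    ℕ → List (ℕ × ℕ) → ℕ → ℕ → ℕ → List (ℕ × ℕ) → List (ℕ × ℕ) → Bool
  | 0, _, _, _, _, _, _ => false
  | _ + 1, _, _, 0, t, rem, l =>
    Nat.blt 0 t || (eq && rem.any fun q => Nat.blt 0 q.2) || leafTest K l
  | _ + 1, [], _, _ + 1, _, _, _ => true
  | n + 1, z :: zs, A, B + 1, t, rem, l =>
    prune eq z.1 z.2 A (B + 1) t rem ||
    (search K eq n zs A (B + 1) t rem l &&
      (Nat.blt (B + 1) z.2 || Nat.blt A z.1 ||
        force (A - z.1) fun A' => force (t - scaledT z.1 z.2) fun t' =>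
          forceList (rem.map fun q => (q.1, q.2 - bend q.1 z.1 z.2)) fun rem' =>
            search K eq n (z :: zs) A' (B + 1 - z.2) t' rem' (z :: l)))

/-- The bounds `2 K (m² - 1)` on the totals of `bend m` for `4 ≤ m ≤ 9`. -/
def bendBounds (K : ℕ) : List (ℕ × ℕ) :=
  [4, 5, 6, 7, 8, 9].map fun m => (m, 2 * K * (m * m - 1))

/-- The `q`-th linear piece of `bend m`. -/
def bendPiece (m q a b : ℤ) : ℤ := b * q * (q + 1) + m * m * a - m * a - 2 * m * a * q

theorem bend_eq_bendPiece {m a b : ℕ} (hb : 0 < b) (hab : 2 * a ≤ b) :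
    (bend m a b : ℤ) = bendPiece m (m * a / b : ℕ) a b := by
  unfold bend bendPiece
  set q := m * a / b with hq
  have h1 : m * a < b * (q + 1) := Nat.lt_mul_div_succ _ hb
  have h2 : 2 * q ≤ m := by
    have h : q ≤ m / 2 := by
      rw [hq]
      calc m * a / b ≤ m * a / (2 * a) := by
            rcases Nat.eq_zero_or_pos a with h | h
            · simp [h]
            · exact Nat.div_le_div_left hab (by omega)
        _ ≤ m / 2 := by
            rcases Nat.eq_zero_or_pos a with h | h
            · simp [h]
            · rw [Nat.mul_div_mul_right _ _ h]
    omega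
  have h3 : m * a + 2 * m * a * q ≤ b * q * (q + 1) + m * m * a := by
    rcases Nat.eq_zero_or_pos q with h0 | h0
    · rw [h0]
      rcases Nat.eq_zero_or_pos m with hm | hm
      · simp [hm]
      · nlinarith [Nat.mul_le_mul_right (m * a) hm]
    · have h4 : m * a * q ≤ b * q * (q + 1) := by nlinarith
      have h5 : m * a * (q + 1) ≤ m * a * m := Nat.mul_le_mul_left _ (by omega)
      nlinarith
  push_cast [h3]
  ring

theorem bend_le_bendPiece {m a b : ℕ} (hb : 0 < b) (hab : 2 * a ≤ b) (q : ℤ) :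
    (bend m a b : ℤ) ≤ bendPiece m q a b := by
  rw [bend_eq_bendPiece hb hab]
  have h1 : (m * a : ℤ) < b * ((m * a / b : ℕ) + 1) := mod_cast Nat.lt_mul_div_succ _ hb
  have h2 : (b * (m * a / b : ℕ) : ℤ) ≤ m * a := mod_cast Nat.mul_div_le _ _
  generalize ((m * a / b : ℕ) : ℤ) = p at h1 h2
  have hb' : (0 : ℤ) < b := mod_cast hb
  unfold bendPiece
  rcases lt_trichotomy p q with h | h | h
  · have : (b * (2 * p + 2) : ℤ) ≤ b * (q + p + 1) :=
      mul_le_mul_of_nonneg_left (by omega) hb'.le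
    nlinarith [mul_nonneg (sub_nonneg.2 h.le)
      (show (0 : ℤ) ≤ b * (q + p + 1) - 2 * (m * a) by linarith)]
  · rw [h]
  · have : (b * (q + p + 1) : ℤ) ≤ b * (2 * p) :=
      mul_le_mul_of_nonneg_left (by omega) hb'.le
    nlinarith [mul_nonneg (sub_nonneg.2 h.le)
      (show (0 : ℤ) ≤ 2 * (m * a) - b * (q + p + 1) by linarith)]

/-- A pair `(a, b)` stands for a fraction in `[0, 1/2]` with denominator dividing `lcmDen`. -/
def IsFrac (p : ℕ × ℕ) : Prop := 0 < p.2 ∧ 2 * p.1 ≤ p.2 ∧ p.2 ∣ lcmDen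

/-- The sum of the numerators. -/
def sumNum (P : Multiset (ℕ × ℕ)) : ℕ := (P.map Prod.fst).sum

/-- The sum of the denominators. -/
def sumDen (P : Multiset (ℕ × ℕ)) : ℕ := (P.map Prod.snd).sum

/-- The total of `scaledT`. -/
def sumT (P : Multiset (ℕ × ℕ)) : ℕ := (P.map fun p => scaledT p.1 p.2).sum

/-- The total of `bend m`. -/
def sumBend (m : ℕ) (P : Multiset (ℕ × ℕ)) : ℕ := (P.map fun p => bend m p.1 p.2).sum

@[simp] theorem sumNum_cons (p : ℕ × ℕ) (P : Multiset (ℕ × ℕ)) :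
    sumNum (p ::ₘ P) = p.1 + sumNum P := by simp [sumNum]

@[simp] theorem sumDen_cons (p : ℕ × ℕ) (P : Multiset (ℕ × ℕ)) :
    sumDen (p ::ₘ P) = p.2 + sumDen P := by simp [sumDen]

@[simp] theorem sumT_cons (p : ℕ × ℕ) (P : Multiset (ℕ × ℕ)) :
    sumT (p ::ₘ P) = scaledT p.1 p.2 + sumT P := by simp [sumT]

@[simp] theorem sumBend_cons (m : ℕ) (p : ℕ × ℕ) (P : Multiset (ℕ × ℕ)) :
    sumBend m (p ::ₘ P) = bend m p.1 p.2 + sumBend m P := by simp [sumBend]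

@[simp] theorem sumNum_zero : sumNum 0 = 0 := rfl
@[simp] theorem sumDen_zero : sumDen 0 = 0 := rfl
@[simp] theorem sumT_zero : sumT 0 = 0 := rfl
@[simp] theorem sumBend_zero (m : ℕ) : sumBend m 0 = 0 := rfl

theorem sumBend_coe (m : ℕ) (l : List (ℕ × ℕ)) : sumBend m l = listBend m l := by
  induction l with
  | nil => rfl
  | cons p l ih => rw [← Multiset.cons_coe, sumBend_cons, ih, listBend]

theorem two_mul_sumNum_le {P : Multiset (ℕ × ℕ)} (hP : ∀ p ∈ P, IsFrac p) :
    2 * sumNum P ≤ sumDen P := by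
  induction P using Multiset.induction with
  | empty => simp
  | cons p P ih =>
    have h := ih fun x hx => hP x (Multiset.mem_cons_of_mem hx)
    have h' := (hP p (Multiset.mem_cons_self _ _)).2.1
    simp only [sumNum_cons, sumDen_cons]
    omega

theorem mul_sumDen_le {P : Multiset (ℕ × ℕ)} {a b : ℕ}
    (hP : ∀ p ∈ P, a * p.2 ≤ p.1 * b) : a * sumDen P ≤ sumNum P * b := by
  induction P using Multiset.induction with
  | empty => simp
  | cons p P ih =>
    have h := ih fun x hx => hP x (Multiset.mem_cons_of_mem hx)
    have h' := hP p (Multiset.mem_cons_self _ _)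
    simp only [sumNum_cons, sumDen_cons]
    linarith

theorem sumBend_le_bendPiece {P : Multiset (ℕ × ℕ)} (hP : ∀ p ∈ P, IsFrac p) (m : ℕ) (q : ℤ) :
    (sumBend m P : ℤ) ≤ bendPiece m q (sumNum P) (sumDen P) := by
  induction P using Multiset.induction with
  | empty => simp [bendPiece]
  | cons p P ih =>
    have h := ih fun x hx => hP x (Multiset.mem_cons_of_mem hx)
    have hp := hP p (Multiset.mem_cons_self _ _)
    have h' := bend_le_bendPiece (m := m) hp.1 hp.2.1 q
    simp only [sumNum_cons, sumDen_cons, sumBend_cons]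
    unfold bendPiece at *
    push_cast
    linarith

theorem sumBend_le_bend {P : Multiset (ℕ × ℕ)} (hP : ∀ p ∈ P, IsFrac p) (m : ℕ)
    (h : 0 < sumDen P) : sumBend m P ≤ bend m (sumNum P) (sumDen P) := by
  have := sumBend_le_bendPiece hP m (m * sumNum P / sumDen P : ℕ)
  rw [← bend_eq_bendPiece h (two_mul_sumNum_le hP)] at this
  exact_mod_cast this

theorem chord_le_bend {a b : ℕ} (hb : 0 < b) (hab : 2 * a ≤ b) {p : ℕ × ℕ} (hp : IsFrac p)
    (hle : a * p.2 ≤ p.1 * b) (m : ℕ) :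
    ((p.2 - 2 * p.1) * bend m a b + (p.1 * b - a * p.2) * bend m 1 2 : ℤ)
      ≤ (b - 2 * a) * bend m p.1 p.2 := by
  rw [bend_eq_bendPiece hp.1 hp.2.1]
  have h1 := bend_le_bendPiece (m := m) hb hab (m * p.1 / p.2 : ℕ)
  have h2 := bend_le_bendPiece (m := m) (a := 1) (b := 2) (by norm_num) le_rfl (m * p.1 / p.2 : ℕ)
  generalize ((m * p.1 / p.2 : ℕ) : ℤ) = q at *
  have h3 : (0 : ℤ) ≤ p.2 - 2 * p.1 := by have := hp.2.1; omega
  have h4 : (0 : ℤ) ≤ p.1 * b - a * p.2 := sub_nonneg.2 (mod_cast hle)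
  refine (add_le_add (mul_le_mul_of_nonneg_left h1 h3)
    (mul_le_mul_of_nonneg_left h2 h4)).trans_eq ?_
  unfold bendPiece
  push_cast
  ring

theorem chord_le_sumBend {a b : ℕ} (hb : 0 < b) (hab : 2 * a ≤ b) {P : Multiset (ℕ × ℕ)}
    (hP : ∀ p ∈ P, IsFrac p) (hle : ∀ p ∈ P, a * p.2 ≤ p.1 * b) (m : ℕ) :
    ((sumDen P - 2 * sumNum P) * bend m a b + (sumNum P * b - a * sumDen P) * bend m 1 2 : ℤ)
      ≤ (b - 2 * a) * sumBend m P := by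
  induction P using Multiset.induction with
  | empty => simp
  | cons p P ih =>
    have h := ih (fun x hx => hP x (Multiset.mem_cons_of_mem hx))
      fun x hx => hle x (Multiset.mem_cons_of_mem hx)
    have h' := chord_le_bend hb hab (hP p (Multiset.mem_cons_self _ _))
      (hle p (Multiset.mem_cons_self _ _)) m
    simp only [sumNum_cons, sumDen_cons, sumBend_cons]
    push_cast
    linarith

theorem scaledT_mul {p : ℕ × ℕ} (hp : IsFrac p) :
    (scaledT p.1 p.2 * p.2 : ℤ) = lcmDen * (p.1 * (p.2 - p.1)) := by
  obtain ⟨h0, h1, c, hc⟩ := hp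
  have h2 : p.1 ≤ p.2 := by omega
  rw [scaledT, hc, Nat.mul_div_cancel_left _ h0]
  push_cast [h2]
  ring

/-- The tangent bound for the concave function `x ↦ x (1 - x)` at `A / B`. -/
theorem scaledT_le_tangent {p : ℕ × ℕ} (hp : IsFrac p) (A B : ℤ) :
    scaledT p.1 p.2 * B ^ 2 ≤ lcmDen * (p.1 * (B ^ 2 - 2 * A * B) + A ^ 2 * p.2) := by
  have h := scaledT_mul hp
  have hb : (0 : ℤ) < p.2 := mod_cast hp.1
  refine le_of_mul_le_mul_right ?_ hb
  have : (0 : ℤ) ≤ lcmDen * (A * p.2 - p.1 * B) ^ 2 := by positivity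
  linear_combination this + B ^ 2 * h

theorem sumT_mul_sumDen_le {P : Multiset (ℕ × ℕ)} (hP : ∀ p ∈ P, IsFrac p) :
    sumT P * sumDen P ≤ lcmDen * (sumNum P * (sumDen P - sumNum P)) := by
  have key : ∀ A B : ℤ, sumT P * B ^ 2 ≤
      lcmDen * (sumNum P * (B ^ 2 - 2 * A * B) + A ^ 2 * sumDen P) := by
    intro A B
    induction P using Multiset.induction with
    | empty => simp
    | cons p P ih =>
      have h := ih fun x hx => hP x (Multiset.mem_cons_of_mem hx)
      have h' := scaledT_le_tangent (hP p (Multiset.mem_cons_self _ _)) A B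
      simp only [sumNum_cons, sumDen_cons, sumT_cons]
      push_cast
      linarith
  have h2 := two_mul_sumNum_le hP
  rcases Nat.eq_zero_or_pos (sumDen P) with h0 | h0
  · simp [h0]
  have hk := key (sumNum P) (sumDen P)
  zify [show sumNum P ≤ sumDen P by omega]
  refine le_of_mul_le_mul_right ?_ (show (0 : ℤ) < sumDen P from mod_cast h0)
  linarith

/-- The requirements a completion `P` has to meet in `search`. -/
structure Meets (eq : Bool) (A B t : ℕ) (rem : List (ℕ × ℕ)) (P : Multiset (ℕ × ℕ)) : Prop where
  num : sumNum P = A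
  den : sumDen P = B
  le_sumT : t ≤ sumT P
  bend_le : ∀ q ∈ rem, sumBend q.1 P ≤ q.2
  le_bend : eq = true → ∀ q ∈ rem, q.2 ≤ sumBend q.1 P

theorem blt_eq_false {a b : ℕ} : Nat.blt a b = false ↔ b ≤ a := by
  rw [← Bool.not_eq_true, Nat.blt_eq, not_lt]

theorem Meets.prune_eq_false {eq : Bool} {a b A B t : ℕ} {rem : List (ℕ × ℕ)}
    {P : Multiset (ℕ × ℕ)} (h : Meets eq A B t rem P) (hb : 0 < b) (hab : 2 * a ≤ b) (hB : 0 < B)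
    (hP : ∀ p ∈ P, IsFrac p) (hle : ∀ p ∈ P, a * p.2 ≤ p.1 * b) :
    prune eq a b A B t rem = false := by
  obtain ⟨rfl, rfl, ht, h1, h2⟩ := h
  have hcone := mul_sumDen_le hle
  have htwo := two_mul_sumNum_le hP
  simp only [prune, Bool.or_eq_false_iff, List.any_eq_false, Bool.and_eq_false_imp,
    blt_eq_false, Nat.blt_eq, not_lt]
  refine ⟨⟨⟨⟨hcone, htwo⟩, ?_⟩, fun q hq => ?_⟩, fun heq q hq => ?_⟩
  · exact (Nat.mul_le_mul_right _ ht).trans (sumT_mul_sumDen_le hP)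
  · refine le_trans ?_ (Nat.mul_le_mul_right _ (h1 q hq))
    have := chord_le_sumBend hb hab hP hle q.1
    zify [htwo, hcone, hab]
    linarith
  · exact (h2 heq q hq).trans (sumBend_le_bend hP q.1 hB)

/-- The monotonicity of `h` along divisibility. -/
def BendMono (K : ℕ) (P : Multiset (ℕ × ℕ)) : Prop :=
  ∀ m d : ℕ, 0 < d → 0 < m → d ∣ m →
    2 * K * (d * d) + sumBend m P ≤ 2 * K * (m * m) + sumBend d P

theorem eq_extremal_of_leafTest {K : ℕ} {l : List (ℕ × ℕ)} (h : leafTest K l = true)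
    (hcard : 9 ≤ l.length) (hmono : BendMono K l) : l = extremal := by
  simp only [leafTest, Bool.or_eq_true, Nat.blt_eq, beq_iff_eq] at h
  rcases h with (h | h) | h
  · omega
  · exfalso
    simp only [List.any_eq_true, Nat.blt_eq, ← sumBend_coe] at h
    obtain ⟨q, hq, hlt⟩ := h
    refine absurd (hmono q.1 q.2 ?_ ?_ ?_) (not_le.2 hlt) <;> clear hlt <;> revert q <;> decide
  · exact h

theorem search_sound {K : ℕ} {eq : Bool} {n : ℕ} {zs : List (ℕ × ℕ)} {A B t : ℕ}
    {rem l : List (ℕ × ℕ)} (hs : search K eq n zs A B t rem l = true)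
    (hzs : ∀ p ∈ zs, IsFrac p) (hsort : zs.Pairwise fun p q => p.1 * q.2 ≤ q.1 * p.2)
    {P : Multiset (ℕ × ℕ)} (hP : ∀ p ∈ P, p ∈ zs) (hm : Meets eq A B t rem P)
    (hcard : 9 ≤ Multiset.card (P + (l : Multiset (ℕ × ℕ))))
    (hmono : BendMono K (P + (l : Multiset (ℕ × ℕ)))) :
    P + (l : Multiset (ℕ × ℕ)) = extremal := by
  induction n generalizing zs A B t rem l P with
  | zero => simp [search] at hs
  | succ n ih =>
    have hfrac : ∀ p ∈ P, IsFrac p := fun p hp => hzs p (hP p hp)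
    cases B with
    | zero =>
      have hP0 : P = 0 := by
        refine Multiset.eq_zero_of_forall_notMem fun p hp => ?_
        have h1 := (hfrac p hp).1
        obtain ⟨Q, rfl⟩ := Multiset.exists_cons_of_mem hp
        have := hm.den
        simp at this
        omega
      subst hP0
      simp only [search, Bool.or_eq_true, Nat.blt_eq, Bool.and_eq_true, List.any_eq_true] at hs
      rcases hs with (hs | ⟨heq, q, hq, hs⟩) | hs
      · have := hm.le_sumT
        simp at this
        omega
      · have := hm.le_bend heq q hq
        simp at this
        omega
      · rw [zero_add] at hcard hmono ⊢
        exact congrArg _ (eq_extremal_of_leafTest hs (by simpa using hcard) hmono)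
    | succ B =>
      cases zs with
      | nil =>
        have hP0 : P = 0 := Multiset.eq_zero_of_forall_notMem fun p hp => by simpa using hP p hp
        have := hm.den
        simp [hP0] at this
      | cons z zs =>
        have hz := hzs z List.mem_cons_self
        have hprune : prune eq z.1 z.2 A (B + 1) t rem = false := by
          refine hm.prune_eq_false hz.1 hz.2.1 B.succ_pos hfrac fun p hp => ?_
          rcases List.mem_cons.1 (hP p hp) with rfl | h
          · exact le_rfl
          · exact (List.pairwise_cons.1 hsort).1 p h
        rw [search, hprune, Bool.false_or, Bool.and_eq_true, force_eq, force_eq, forceList_eq] at hs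
        by_cases hmem : z ∈ P
        · obtain ⟨Q, rfl⟩ := Multiset.exists_cons_of_mem hmem
          obtain ⟨hA, hB, ht, h1, h2⟩ := hm
          simp only [sumNum_cons, sumDen_cons, sumT_cons, sumBend_cons] at hA hB ht h1 h2
          have hs2 := hs.2
          simp only [Bool.or_eq_true, Nat.blt_eq] at hs2
          rcases hs2 with (h | h) | h
          · omega
          · omega
          · have hshift : z ::ₘ Q + (l : Multiset (ℕ × ℕ)) = Q + ((z :: l : List (ℕ × ℕ))) := by
              rw [← Multiset.cons_coe, Multiset.add_cons, Multiset.cons_add]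
            rw [hshift] at hcard hmono ⊢
            refine ih h hzs hsort (fun p hp => hP p (Multiset.mem_cons_of_mem hp))
              ⟨by omega, by omega, by omega, ?_, fun heq => ?_⟩ hcard hmono
            · rintro _ hq
              obtain ⟨q, hq', rfl⟩ := List.mem_map.1 hq
              have := h1 q hq'
              simp only
              omega
            · rintro _ hq
              obtain ⟨q, hq', rfl⟩ := List.mem_map.1 hq
              have := h2 heq q hq'
              simp only
              omega
        · refine ih hs.1 (fun p hp => hzs p (List.mem_cons_of_mem _ hp))
            (List.pairwise_cons.1 hsort).2 (fun p hp => ?_) hm hcard hmono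
          rcases List.mem_cons.1 (hP p hp) with rfl | h
          · exact absurd hp hmem
          · exact h

theorem isFrac_of_mem_halfFarey : ∀ p ∈ halfFarey, IsFrac p := by
  unfold IsFrac
  decide +kernel

theorem halfFarey_sorted : halfFarey.Pairwise fun p q => p.1 * q.2 ≤ q.1 * p.2 := by
  decide +kernel

theorem mem_halfFarey {a b : ℕ} (hb : 0 < b) (hb' : b ≤ 28) (hab : 2 * a ≤ b)
    (hcop : a.Coprime b) : (a, b) ∈ halfFarey := by
  have key : ∀ b : Fin 29, ∀ a : Fin 15, 0 < b.val → 2 * a.val ≤ b.val →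
      Nat.gcd a.val b.val = 1 → (a.val, b.val) ∈ halfFarey := by
    decide +kernel
  exact key ⟨b, by omega⟩ ⟨a, by omega⟩ hb hab hcop

/-- The numerator and denominator of a nonnegative rational number. -/
def toPair (z : ℚ) : ℕ × ℕ := (z.num.toNat, z.den)

theorem cast_toPair {z : ℚ} (h0 : 0 ≤ z) : ((toPair z).1 : ℚ) = z * z.den := by
  have h : ((z.num.toNat : ℤ) : ℚ) = z.num := by rw [Int.toNat_of_nonneg (Rat.num_nonneg.2 h0)]
  rw [Rat.mul_den_eq_num, ← h]
  rfl

theorem two_mul_toPair_le {z : ℚ} (h0 : 0 ≤ z) (h1 : z ≤ 1 / 2) :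
    2 * (toPair z).1 ≤ (toPair z).2 := by
  have h2 : (0 : ℚ) < z.den := mod_cast z.pos
  have h : (2 * (toPair z).1 : ℚ) ≤ z.den := by
    rw [cast_toPair h0]
    nlinarith
  exact_mod_cast h

theorem toPair_mem_halfFarey {z : ℚ} (h0 : 0 ≤ z) (h1 : z ≤ 1 / 2) (hden : z.den ≤ 28) :
    toPair z ∈ halfFarey := by
  refine mem_halfFarey z.pos hden (two_mul_toPair_le h0 h1) ?_
  have h : z.num.natAbs = z.num.toNat := by
    have := Rat.num_nonneg.2 h0
    omega
  exact h ▸ z.reduced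

theorem den_mul_bernB_s17 {z : ℚ} (h0 : 0 ≤ z) (h1 : z ≤ 1 / 2) (hden : (toPair z).2 ∣ lcmDen)
    (m : ℕ) : (z.den : ℚ) * bernB (m * z) = z.den / 6
      - m ^ 2 * (scaledT (toPair z).1 (toPair z).2 / lcmDen) + bend m (toPair z).1 (toPair z).2 := by
  have hb : (0 : ℚ) < z.den := mod_cast z.pos
  have hle := two_mul_toPair_le h0 h1
  have hT := scaledT_mul (p := toPair z) ⟨z.pos, hle, hden⟩
  have hbend := bend_eq_bendPiece (m := m) (a := (toPair z).1) (b := (toPair z).2) z.pos hle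
  have ha := cast_toPair h0
  have hfloor : ⌊(m * z : ℚ)⌋ = (m * (toPair z).1 / (toPair z).2 : ℕ) := by
    have : (m * z : ℚ) = (m * (toPair z).1 : ℕ) / ((toPair z).2 : ℕ) := by
      push_cast
      rw [ha]
      change _ = _ / (z.den : ℚ)
      field_simp
    rw [this, Rat.floor_natCast_div_natCast]
    norm_cast
  unfold bernB Int.fract
  rw [hfloor]
  generalize m * (toPair z).1 / (toPair z).2 = q at *
  have hT' : (scaledT (toPair z).1 (toPair z).2 * z.den : ℚ) =
      lcmDen * ((toPair z).1 * (z.den - (toPair z).1)) := by exact_mod_cast hT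
  have hbend' : (bend m (toPair z).1 (toPair z).2 : ℚ) = z.den * q * (q + 1)
      + m * m * (toPair z).1 - m * (toPair z).1 - 2 * m * (toPair z).1 * q := by
    have := congrArg (Int.cast : ℤ → ℚ) hbend
    unfold bendPiece at this
    push_cast at this
    exact this
  have hL : (lcmDen : ℚ) ≠ 0 := by norm_num [lcmDen]
  have hT'' : (scaledT (toPair z).1 (toPair z).2 / lcmDen : ℚ) = z * z.den - z ^ 2 * z.den := by
    rw [div_eq_iff hL]
    refine mul_right_cancel₀ hb.ne' ?_
    rw [hT', ha]
    ring
  rw [hT'', hbend', ha]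
  push_cast
  ring

theorem lamS_eq {S : Multiset ℚ} (hS : ∀ z ∈ S, 0 ≤ z ∧ z ≤ 1 / 2)
    (hden : ∀ z ∈ S, (toPair z).2 ∣ lcmDen) (m : ℕ) :
    lamS m S = dS S / 6 - m ^ 2 * (sumT (S.map toPair) / lcmDen) + sumBend m (S.map toPair) := by
  induction S using Multiset.induction with
  | empty => simp [lamS, dS]
  | cons z S ih =>
    have h := ih (fun x hx => hS x (Multiset.mem_cons_of_mem hx))
      fun x hx => hden x (Multiset.mem_cons_of_mem hx)
    have hz := hS z (Multiset.mem_cons_self _ _)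
    have h' := den_mul_bernB_s17 hz.1 hz.2 (hden z (Multiset.mem_cons_self _ _)) m
    simp only [lamS, dS, Multiset.map_cons, Multiset.sum_cons, sumT_cons, sumBend_cons] at h ⊢
    rw [h, h']
    push_cast
    ring

theorem den_le_of_mem {S : Multiset ℚ} {z : ℚ} (hz : z ∈ S) :
    z.den + Multiset.card S ≤ dS S + 1 := by
  obtain ⟨S, rfl⟩ := Multiset.exists_cons_of_mem hz
  have : Multiset.card S ≤ dS S := by
    have := Multiset.card_nsmul_le_sum (s := S.map Rat.den) (a := 1) fun x hx => by
      obtain ⟨y, -, rfl⟩ := Multiset.mem_map.1 hx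
      exact y.pos
    simpa [dS] using this
  simp only [dS, Multiset.map_cons, Multiset.sum_cons, Multiset.card_cons] at this ⊢
  omega

theorem sumDen_map_toPair (S : Multiset ℚ) : sumDen (S.map toPair) = dS S := by
  rw [sumDen, dS, Multiset.map_map]
  rfl

theorem sumBend_one {P : Multiset (ℕ × ℕ)} (hP : ∀ p ∈ P, IsFrac p) : sumBend 1 P = 0 := by
  have := sumBend_le_bendPiece hP 1 0
  simp only [bendPiece] at this
  push_cast at this
  omega

theorem sumBend_two {P : Multiset (ℕ × ℕ)} (hP : ∀ p ∈ P, p ∈ halfFarey) :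
    sumBend 2 P = 2 * sumNum P := by
  have key : ∀ p ∈ halfFarey, bend 2 p.1 p.2 = 2 * p.1 := by decide +kernel
  rw [sumBend, sumNum, ← Multiset.sum_map_mul_left]
  exact congrArg _ (Multiset.map_congr rfl fun p hp => key p (hP p hp))

theorem search_extremal_exact : search 3 true 200 halfFarey 9 36 0 (bendBounds 3) [] = true := by
  decide +kernel

theorem search_extremal {K A : ℕ} (hK : K = 3 ∨ K = 4) (hA : A ≤ 3 * K) :
    search K false 200 halfFarey A 36 (2 * K * lcmDen - lcmDen / 840 * 23) (bendBounds K) []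
      = true := by
  have h3 : ∀ A < 10, search 3 false 200 halfFarey A 36
      (2 * 3 * lcmDen - lcmDen / 840 * 23) (bendBounds 3) [] = true := by decide +kernel
  have h4 : ∀ A < 13, search 4 false 200 halfFarey A 36
      (2 * 4 * lcmDen - lcmDen / 840 * 23) (bendBounds 4) [] = true := by decide +kernel
  rcases hK with rfl | rfl
  · exact h3 A (by omega)
  · exact h4 A (by omega)

theorem stmt_17 (S : Multiset ℚ) (H : ℚ) (hadm : Admissible S H)
    (hmu : MoebiusCond S H) (hcard : 9 ≤ Multiset.card S) (hd : dS S = 36) :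
    23 / 840 ≤ H ∧ (H = 23 / 840 ↔ ∀ m : ℕ, 1 ≤ m → m ≤ 9 → hS m S H = 0) := by
  obtain ⟨hrange, hH, heven, hmono⟩ := hadm
  set P := S.map toPair with hPdef
  have hP : ∀ p ∈ P, p ∈ halfFarey := by
    intro p hp
    obtain ⟨z, hz, rfl⟩ := Multiset.mem_map.1 hp
    have := den_le_of_mem hz
    exact toPair_mem_halfFarey (hrange z hz).1 (hrange z hz).2 (by omega)
  have hfrac : ∀ p ∈ P, IsFrac p := fun p hp => isFrac_of_mem_halfFarey p (hP p hp)
  have hcardP : 9 ≤ Multiset.card P := by simpa [hPdef] using hcard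
  have hdenP : sumDen P = 36 := (sumDen_map_toPair S).trans hd
  have hL : (0 : ℚ) < lcmDen := by norm_num [lcmDen]
  have hh : ∀ m : ℕ, hS m S H = m ^ 2 * (H + sumT P / lcmDen) - 6 - sumBend m P := by
    intro m
    rw [hS, lamS_eq hrange
      (fun z hz => (hfrac _ (Multiset.mem_map_of_mem toPair hz)).2.2) m, hd]
    push_cast
    ring
  obtain ⟨k, hk⟩ := heven 1 one_pos
  have hHT : H + sumT P / lcmDen = 2 * (3 + k) := by
    rw [hh, sumBend_one hfrac] at hk
    push_cast at hk
    linarith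
  have hmonoP : BendMono (3 + k) P := by
    intro m d hd0 hm0 hdm
    have h := hmono m d hd0 hm0 hdm
    rw [hh, hh, hHT] at h
    have : (2 * (3 + k) * (d * d) + sumBend m P : ℚ) ≤
        2 * (3 + k) * (m * m) + sumBend d P := by linarith
    exact_mod_cast this
  have hbound : ∀ m : ℕ, 0 < m → sumBend m P ≤ 2 * (3 + k) * (m * m - 1) := by
    intro m hm0
    have h := hmonoP m 1 one_pos hm0 (one_dvd m)
    rw [sumBend_one hfrac] at h
    have : 1 ≤ m * m := Nat.mul_pos hm0 hm0
    zify [this] at h ⊢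
    linarith
  have hnum : sumNum P ≤ 3 * (3 + k) := by
    have := hbound 2 two_pos
    rw [sumBend_two hP] at this
    omega
  have hext : P = extremal → H ≤ 23 / 840 ∨ hS 1 S H = 0 →
      H = 23 / 840 ∧ ∀ m : ℕ, 1 ≤ m → m ≤ 9 → hS m S H = 0 := by
    intro hPe hor
    have hT : (sumT P / lcmDen : ℚ) = 6 - 23 / 840 := by
      have : sumT P = 479681540910 := by rw [hPe]; decide
      rw [this]
      norm_num [lcmDen]
    have hHk : H = 2 * k + 23 / 840 := by linarith
    have hk0 : (k : ℚ) = 0 := by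
      have : (0 : ℚ) ≤ k := k.cast_nonneg
      rcases hor with h | h <;> linarith
    refine ⟨by rw [hHk, hk0]; norm_num, fun m hm1 hm9 => ?_⟩
    have hbend : sumBend m P = 6 * (m * m - 1) := by
      rw [hPe, sumBend_coe]
      interval_cases m <;> rfl
    rw [hh, hHT, hk0, hbend]
    interval_cases m <;> norm_num
  have hsmall : H ≤ 23 / 840 → P = extremal := by
    intro hle
    have hTle : sumT P ≤ 9 * lcmDen := by
      have h := sumT_mul_sumDen_le hfrac
      rw [hdenP] at h
      have h2 : sumNum P * (36 - sumNum P) ≤ 324 := by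
        have : sumNum P ≤ 18 := by
          have := two_mul_sumNum_le hfrac
          omega
        interval_cases sumNum P <;> norm_num
      have := Nat.mul_le_mul_left lcmDen h2
      omega
    have hTle' : (sumT P / lcmDen : ℚ) ≤ 9 := by
      rw [div_le_iff₀ hL]
      exact_mod_cast hTle
    have hk2 : k < 2 := by
      by_contra! h
      have : (2 : ℚ) ≤ k := by exact_mod_cast h
      linarith
    have ht : 2 * (3 + k) * lcmDen - lcmDen / 840 * 23 ≤ sumT P := by
      have h : (2 * (3 + k) - 23 / 840 : ℚ) ≤ sumT P / lcmDen := by linarith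
      rw [le_div_iff₀ hL] at h
      have h840 : (lcmDen : ℚ) = 840 * (lcmDen / 840 : ℕ) := by norm_num [lcmDen]
      rw [Nat.sub_le_iff_le_add]
      have : ((2 * (3 + k) * lcmDen : ℕ) : ℚ) ≤ (sumT P + lcmDen / 840 * 23 : ℕ) := by
        push_cast
        linarith
      exact_mod_cast this
    have := search_sound (search_extremal (K := 3 + k) (by omega) hnum) isFrac_of_mem_halfFarey
      halfFarey_sorted hP ⟨rfl, hdenP, ht, fun q hq => ?_, by simp⟩
      (by simpa using hcardP) (by simpa using hmonoP)
    · simpa using this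
    · obtain ⟨m, hm, rfl⟩ := List.mem_map.1 hq
      refine hbound m ?_
      simp at hm
      omega
  have hexact : (∀ m : ℕ, 1 ≤ m → m ≤ 9 → hS m S H = 0) → P = extremal := by
    intro h0
    obtain rfl : k = 0 := by
      rw [h0 1 le_rfl (by norm_num)] at hk
      have : (k : ℚ) = 0 := by linarith
      exact_mod_cast this
    have hbend : ∀ m : ℕ, 1 ≤ m → m ≤ 9 → sumBend m P = 2 * 3 * (m * m - 1) := by
      intro m hm1 hm9
      have h := h0 m hm1 hm9
      rw [hh, hHT] at h
      have : 1 ≤ m * m := Nat.mul_pos hm1 hm1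
      qify [this]
      push_cast at h
      linarith
    have hnum9 : sumNum P = 9 := by
      have := hbend 2 (by norm_num) (by norm_num)
      rw [sumBend_two hP] at this
      omega
    have hrem : ∀ q ∈ bendBounds 3, sumBend q.1 P = q.2 := by
      intro q hq
      obtain ⟨m, hm, rfl⟩ := List.mem_map.1 hq
      simp at hm
      exact hbend m (by omega) (by omega)
    have := search_sound search_extremal_exact isFrac_of_mem_halfFarey halfFarey_sorted hP
      ⟨hnum9, hdenP, Nat.zero_le _, fun q hq => (hrem q hq).le, fun _ q hq => (hrem q hq).ge⟩
      (by simpa using hcardP) (by simpa using hmonoP)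
    simpa using this
  refine ⟨?_, fun h => (hext (hsmall h.le) (.inl h.le)).2,
    fun h => (hext (hexact h) (.inr (h 1 le_rfl (by norm_num)))).1⟩
  by_contra! h
  exact h.ne (hext (hsmall h.le) (.inl h.le)).1
end
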